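/- Suppose the coefficients depend only on x_1 and are smooth in x_1: A^{αβ}(t,x) = Ā^{αβ}(x_1) with each Ā^{αβ} a C^∞ function of one real variable satisfying the bound and ellipticity conditions with constant δ. Suppose u : ℝ^{1+d} → ℝ^m is smooth and satisfies −u_t + D_α(A^{αβ}D_βu) = 0 weakly in Q_4, and set U = Σ_{β=1}^d Ā^{1β}(x_1) D_βu. Then for all nonnegative integers i, j and every partial derivative D_{x'}^j of order j taken only with respect to x_2,…,x_d, one has ‖∂_t^i D_{x'}^j U‖_{L_2(Q_2)} + ‖∂_t^i D_{x'}^j D_1 U‖_{L_2(Q_2)} ≤ N ‖Du‖_{L_2(Q_4)}, where N = N(d,m,δ,i,j) does not depend on any smoothness norms of Ā. -/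

import Mathlib

open MeasureTheory Metric Set Function
open scoped ENNReal NNReal RealInnerProductSpace BigOperators

noncomputable section

/-- `ℝ^d` with the Euclidean norm. -/
abbrev Ed (d : ℕ) : Type := EuclideanSpace ℝ (Fin d)
/-- `ℝ^m` with the Euclidean norm. -/
abbrev Em (m : ℕ) : Type := EuclideanSpace ℝ (Fin m)
/-- `m × m` real matrices, viewed as linear operators on `ℝ^m`. -/
abbrev CLM (m : ℕ) : Type := Em m →L[ℝ] Em m

/-- Spatial partial derivative `D_α u` of a function on `ℝ^{1+d}`. -/
def pd {d : ℕ} {F : Type*} [NormedAddCommGroup F] [NormedSpace ℝ F]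
    (α : Fin d) (u : ℝ × Ed d → F) (q : ℝ × Ed d) : F :=
  fderiv ℝ u q (0, EuclideanSpace.single α 1)

/-- Time derivative `∂_t u` of a function on `ℝ^{1+d}`. -/
def pt {d : ℕ} {F : Type*} [NormedAddCommGroup F] [NormedSpace ℝ F]
    (u : ℝ × Ed d → F) (q : ℝ × Ed d) : F :=
  fderiv ℝ u q (1, 0)

/-- `|Du|²`, the squared Euclidean norm of the spatial gradient. -/
def gradSq {d m : ℕ} (u : ℝ × Ed d → Em m) (q : ℝ × Ed d) : ℝ :=
  ∑ α, ‖pd α u q‖ ^ 2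

/-- The parabolic cylinder `Q_r(t,x) = (t - r², t) × B_r(x)`. -/
def Qc {d : ℕ} (r t : ℝ) (x : Ed d) : Set (ℝ × Ed d) :=
  Ioo (t - r ^ 2) t ×ˢ ball x r

/-- `Q_r = Q_r(0,0)`. -/
def Qc0 {d : ℕ} (r : ℝ) : Set (ℝ × Ed d) := Qc r 0 0

/-- Boundedness by `δ⁻¹` together with the ellipticity condition with constant `δ`
for a family of `m × m` matrices. -/
def EllipticPt (δ : ℝ) {d m : ℕ} (a : Fin d → Fin d → CLM m) : Prop :=
  (∀ α β, ‖a α β‖ ≤ δ⁻¹) ∧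
  ∀ ξ : Fin d → Em m, δ * ∑ α, ‖ξ α‖ ^ 2 ≤ ∑ α, ∑ β, ⟪ξ α, a α β (ξ β)⟫

/-- Measurable, bounded, uniformly elliptic coefficients on `ℝ^{1+d}`. -/
def Coeffs (δ : ℝ) {d m : ℕ} (A : Fin d → Fin d → ℝ × Ed d → CLM m) : Prop :=
  (∀ α β, Measurable (A α β)) ∧ ∀ q, EllipticPt δ (fun α β => A α β q)

/-- The class `𝒜`: measurable, bounded, uniformly elliptic coefficients depending on
one real variable. -/
def CoeffsOne (δ : ℝ) {d m : ℕ} (Ab : Fin d → Fin d → ℝ → CLM m) : Prop :=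
  (∀ α β, Measurable (Ab α β)) ∧ ∀ s, EllipticPt δ (fun α β => Ab α β s)

/-- The class `Ψ` of `C^{1,1}` diffeomorphisms of `ℝ^d`: `ψ` and its inverse `φ`
are `C^1` with Lipschitz first derivatives, and `|Dψ| + |D²ψ| ≤ δ⁻¹`,
`|Dφ| + |D²φ| ≤ δ⁻¹` (where the second derivative is measured by the Lipschitz
constant of the first derivative). -/
def IsPsi (δ : ℝ) {d : ℕ} (ψ φ : Ed d → Ed d) : Prop :=
  Function.LeftInverse φ ψ ∧ Function.RightInverse φ ψ ∧
  ContDiff ℝ 1 ψ ∧ ContDiff ℝ 1 φ ∧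
  ∃ K K' : ℝ≥0, LipschitzWith K (fderiv ℝ ψ) ∧ LipschitzWith K' (fderiv ℝ φ) ∧
    (∀ x, ‖fderiv ℝ ψ x‖ + (K : ℝ) ≤ δ⁻¹) ∧ ∀ y, ‖fderiv ℝ φ y‖ + (K' : ℝ) ≤ δ⁻¹

/-- `U = Σ_β Ā^{1β}(x₁) D_β u`. -/
def Ubar {d m : ℕ} [NeZero d] (Ab : Fin d → Fin d → ℝ → CLM m)
    (u : ℝ × Ed d → Em m) (q : ℝ × Ed d) : Em m :=
  ∑ β, Ab 0 β (q.2 0) (pd β u q)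


section helpers
variable {d m : ℕ} {F : Type*} [NormedAddCommGroup F] [NormedSpace ℝ F]

/-- directional derivative -/
def dd (e : ℝ × Ed d) (f : ℝ × Ed d → F) (q : ℝ × Ed d) : F := fderiv ℝ f q e

lemma pd_eq (α : Fin d) (f : ℝ × Ed d → F) : pd α f = dd (0, EuclideanSpace.single α 1) f := rfl

lemma pt_eq (f : ℝ × Ed d → F) : pt f = dd (1, 0) f := rfl

lemma dd_smooth {f : ℝ × Ed d → F} (hf : ContDiff ℝ (⊤ : ℕ∞) f) (e : ℝ × Ed d) :
    ContDiff ℝ (⊤ : ℕ∞) (dd e f) := by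
  have h := hf.fderiv_right (m := (⊤ : ℕ∞)) (by simp)
  exact h.clm_apply contDiff_const

lemma pd_smooth {f : ℝ × Ed d → F} (hf : ContDiff ℝ (⊤ : ℕ∞) f) (α : Fin d) :
    ContDiff ℝ (⊤ : ℕ∞) (pd α f) := dd_smooth hf _

lemma pt_smooth {f : ℝ × Ed d → F} (hf : ContDiff ℝ (⊤ : ℕ∞) f) :
    ContDiff ℝ (⊤ : ℕ∞) (pt f) := dd_smooth hf _

lemma smooth_diff {f : ℝ × Ed d → F} (hf : ContDiff ℝ (⊤ : ℕ∞) f) : Differentiable ℝ f :=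
  hf.differentiable (by simp)

lemma dd_comm {f : ℝ × Ed d → F} (hf : ContDiff ℝ (⊤ : ℕ∞) f) (e e' : ℝ × Ed d) :
    dd e (dd e' f) = dd e' (dd e f) := by
  funext q
  have h1 : Differentiable ℝ (fderiv ℝ f) :=
    (hf.fderiv_right (m := (⊤ : ℕ∞)) (by simp)).differentiable (by simp)
  have hs : IsSymmSndFDerivAt ℝ f q :=
    hf.contDiffAt.isSymmSndFDerivAt (by
      rw [minSmoothness_of_isRCLikeNormedField]
      exact WithTop.coe_le_coe.2 (le_top : (2 : ℕ∞) ≤ ⊤))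
  have key : ∀ a b : ℝ × Ed d, dd a (dd b f) q = fderiv ℝ (fderiv ℝ f) q a b := by
    intro a b
    have : dd b f = fun q => fderiv ℝ f q b := rfl
    unfold dd
    rw [fderiv_clm_apply (h1 q) (differentiableAt_const _)]
    simp
  rw [key, key, hs]

lemma dd_sum {ι : Type*} (s : Finset ι) {f : ι → ℝ × Ed d → F}
    (hf : ∀ i, ContDiff ℝ (⊤ : ℕ∞) (f i)) (e : ℝ × Ed d) (q : ℝ × Ed d) :
    dd e (fun q => ∑ i ∈ s, f i q) q = ∑ i ∈ s, dd e (f i) q := by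
  unfold dd
  rw [fderiv_fun_sum (fun i _ => smooth_diff (hf i) q)]
  simp

lemma coord_smooth [NeZero d] : ContDiff ℝ (⊤ : ℕ∞) (fun q : ℝ × Ed d => q.2 0) := by
  have : (fun q : ℝ × Ed d => q.2 0) =
    fun q => (EuclideanSpace.proj (𝕜 := ℝ) (0 : Fin d)) ((ContinuousLinearMap.snd ℝ ℝ (Ed d)) q) := rfl
  rw [this]
  exact (ContinuousLinearMap.contDiff _).comp (ContinuousLinearMap.contDiff _)

lemma coef_smooth [NeZero d] {a : ℝ → CLM m} (ha : ContDiff ℝ (⊤ : ℕ∞) a)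
    {f : ℝ × Ed d → Em m} (hf : ContDiff ℝ (⊤ : ℕ∞) f) :
    ContDiff ℝ (⊤ : ℕ∞) (fun q : ℝ × Ed d => a (q.2 0) (f q)) :=
  (ha.comp coord_smooth).clm_apply hf

lemma dd_coef [NeZero d] {a : ℝ → CLM m} (ha : ContDiff ℝ (⊤ : ℕ∞) a)
    {f : ℝ × Ed d → Em m} (hf : ContDiff ℝ (⊤ : ℕ∞) f) {e : ℝ × Ed d} (he : e.2 0 = 0)
    (q : ℝ × Ed d) :
    dd e (fun q : ℝ × Ed d => a (q.2 0) (f q)) q = a (q.2 0) (dd e f q) := by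
  have hc : HasFDerivAt (fun q : ℝ × Ed d => q.2 0)
      ((EuclideanSpace.proj (𝕜 := ℝ) (0 : Fin d)).comp (ContinuousLinearMap.snd ℝ ℝ (Ed d))) q :=
    ((EuclideanSpace.proj (𝕜 := ℝ) (0 : Fin d)).comp
      (ContinuousLinearMap.snd ℝ ℝ (Ed d))).hasFDerivAt
  have hA : HasFDerivAt (fun q : ℝ × Ed d => a (q.2 0)) _ q :=
    ((ha.differentiable (by simp)) (q.2 0)).hasFDerivAt.comp q hc
  have := (hA.clm_apply (smooth_diff hf q).hasFDerivAt).fderiv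
  unfold dd
  rw [this]
  simp [he]

/-- the flux `Σ_β A^{αβ} D_β w` -/
def flux [NeZero d] (Ab : Fin d → Fin d → ℝ → CLM m) (w : ℝ × Ed d → Em m) (α : Fin d)
    (q : ℝ × Ed d) : Em m := ∑ β, Ab α β (q.2 0) (pd β w q)

lemma Ubar_eq [NeZero d] (Ab : Fin d → Fin d → ℝ → CLM m) (w : ℝ × Ed d → Em m) :
    Ubar Ab w = flux Ab w 0 := rfl

lemma flux_smooth [NeZero d] {Ab : Fin d → Fin d → ℝ → CLM m}
    (hA : ∀ α β, ContDiff ℝ (⊤ : ℕ∞) (Ab α β)) {w : ℝ × Ed d → Em m}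
    (hw : ContDiff ℝ (⊤ : ℕ∞) w) (α : Fin d) : ContDiff ℝ (⊤ : ℕ∞) (flux Ab w α) := by
  unfold flux
  exact ContDiff.sum fun β _ => coef_smooth (hA α β) (pd_smooth hw β)

lemma dd_flux [NeZero d] {Ab : Fin d → Fin d → ℝ → CLM m}
    (hA : ∀ α β, ContDiff ℝ (⊤ : ℕ∞) (Ab α β)) {w : ℝ × Ed d → Em m}
    (hw : ContDiff ℝ (⊤ : ℕ∞) w) {e : ℝ × Ed d} (he : e.2 0 = 0) (α : Fin d) :
    dd e (flux Ab w α) = flux Ab (dd e w) α := by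
  funext q
  unfold flux
  rw [dd_sum _ (fun β => coef_smooth (hA α β) (pd_smooth hw β))]
  refine Finset.sum_congr rfl fun β _ => ?_
  rw [dd_coef (hA α β) (pd_smooth hw β) he, pd_eq, pd_eq, dd_comm hw]

/-- smooth pointwise solutions in `Q_4` -/
def Sol [NeZero d] (Ab : Fin d → Fin d → ℝ → CLM m) (w : ℝ × Ed d → Em m) : Prop :=
  ContDiff ℝ (⊤ : ℕ∞) w ∧ ∀ q ∈ Qc0 (d := d) 4, pt w q = ∑ α, pd α (flux Ab w α) q

lemma isOpen_Qc0 (r : ℝ) : IsOpen (Qc0 (d := d) r) := by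
  unfold Qc0 Qc; exact isOpen_Ioo.prod isOpen_ball

lemma Sol.dd [NeZero d] {Ab : Fin d → Fin d → ℝ → CLM m}
    (hA : ∀ α β, ContDiff ℝ (⊤ : ℕ∞) (Ab α β)) {w : ℝ × Ed d → Em m}
    (hw : Sol Ab w) {e : ℝ × Ed d} (he : e.2 0 = 0) : Sol Ab (dd e w) := by
  refine ⟨dd_smooth hw.1 e, fun q hq => ?_⟩
  have h1 : _root_.dd e (pt w) q = _root_.dd e (fun q => ∑ α, pd α (flux Ab w α) q) q := by
    unfold _root_.dd
    congr 1
    apply Filter.EventuallyEq.fderiv_eq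
    filter_upwards [(isOpen_Qc0 4).mem_nhds hq] with y hy using hw.2 y hy
  rw [dd_sum _ (fun α => pd_smooth (flux_smooth hA hw.1 α) α)] at h1
  rw [pt_eq, dd_comm hw.1, ← pt_eq, h1]
  refine Finset.sum_congr rfl fun α _ => ?_
  rw [pd_eq, dd_comm (flux_smooth hA hw.1 α), dd_flux hA hw.1 he, pd_eq]

instance instHaar : (volume : Measure (ℝ × Ed d)).IsAddHaarMeasure :=
  inferInstanceAs (((volume : Measure ℝ).prod (volume : Measure (Ed d))).IsAddHaarMeasure)

/-- integration by parts -/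
lemma ibp {φ G : ℝ × Ed d → Em m} (hφ : ContDiff ℝ (⊤ : ℕ∞) φ) (hc : HasCompactSupport φ)
    (hG : ContDiff ℝ (⊤ : ℕ∞) G) (e : ℝ × Ed d) :
    ∫ q, ⟪φ q, dd e G q⟫ = - ∫ q, ⟪dd e φ q, G q⟫ := by
  have hc' : HasCompactSupport (dd e φ) := hc.fderiv_apply (𝕜 := ℝ) e
  have := integral_bilinear_fderiv_right_eq_neg_left_of_integrable (μ := (volume : Measure (ℝ × Ed d)))
    (B := innerSL ℝ) (f := φ) (g := G) (v := e) ?_ ?_ ?_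
    (fun x _ => smooth_diff hφ x) (fun x _ => smooth_diff hG x)
  · exact this
  · refine Continuous.integrable_of_hasCompactSupport
      ((dd_smooth hφ e).continuous.inner hG.continuous) ?_
    exact hc'.mono fun q hq => by
      contrapose! hq
      have hq1 : dd e φ q = 0 := by simpa using hq
      have hq' : fderiv ℝ φ q e = 0 := hq1
      simp [hq']
  · refine Continuous.integrable_of_hasCompactSupport
      (hφ.continuous.inner (dd_smooth hG e).continuous) ?_
    exact hc.mono fun q hq => by
      contrapose! hq
      have hq' : φ q = 0 := by simpa using hq
      simp [hq']
  · refine Continuous.integrable_of_hasCompactSupport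
      (hφ.continuous.inner hG.continuous) ?_
    exact hc.mono fun q hq => by
      contrapose! hq
      have hq' : φ q = 0 := by simpa using hq
      simp [hq']

end helpers

section helpers2
variable {d m : ℕ}

lemma int_inner {φ G : ℝ × Ed d → Em m} (hφ : Continuous φ) (hc : HasCompactSupport φ)
    (hG : Continuous G) : Integrable (fun q => ⟪φ q, G q⟫) := by
  refine Continuous.integrable_of_hasCompactSupport (hφ.inner hG) ?_
  exact hc.mono fun q hq => by
    contrapose! hq
    have hq' : φ q = 0 := by simpa using hq
    simp [hq']

lemma hcs_dd {φ : ℝ × Ed d → Em m} (hc : HasCompactSupport φ) (e : ℝ × Ed d) :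
    HasCompactSupport (dd e φ) := hc.fderiv_apply (𝕜 := ℝ) e

lemma test_identity [NeZero d] {Ab : Fin d → Fin d → ℝ → CLM m}
    (hA : ∀ α β, ContDiff ℝ (⊤ : ℕ∞) (Ab α β)) {w : ℝ × Ed d → Em m} (hw : Sol Ab w)
    {φ : ℝ × Ed d → Em m} (hφ : ContDiff ℝ (⊤ : ℕ∞) φ) (hc : HasCompactSupport φ)
    (hs : tsupport φ ⊆ Qc0 4) :
    ∫ q, ⟪φ q, pt w q⟫ = - ∫ q, ∑ α, ⟪pd α φ q, flux Ab w α q⟫ := by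
  have h1 : ∀ q, ⟪φ q, pt w q⟫ = ∑ α, ⟪φ q, pd α (flux Ab w α) q⟫ := by
    intro q
    by_cases hq : q ∈ tsupport φ
    · rw [hw.2 q (hs hq), inner_sum]
    · simp [image_eq_zero_of_notMem_tsupport hq]
  simp_rw [h1]
  rw [integral_finsetSum _ (fun α _ => int_inner hφ.continuous hc
      (pd_smooth (flux_smooth hA hw.1 α) α).continuous),
    integral_finsetSum _ (fun α _ => int_inner (pd_smooth hφ α).continuous (hcs_dd hc _)
      (flux_smooth hA hw.1 α).continuous), ← Finset.sum_neg_distrib]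
  exact Finset.sum_congr rfl fun α _ => ibp hφ hc (flux_smooth hA hw.1 α) _

lemma sol_of_weak [NeZero d] {Ab : Fin d → Fin d → ℝ → CLM m}
    (hA : ∀ α β, ContDiff ℝ (⊤ : ℕ∞) (Ab α β)) {u : ℝ × Ed d → Em m}
    (hu : ContDiff ℝ (⊤ : ℕ∞) u)
    (h : ∀ φt : ℝ × Ed d → Em m, ContDiff ℝ (⊤ : ℕ∞) φt → HasCompactSupport φt →
      tsupport φt ⊆ Qc0 4 →
      ∫ q, (⟪u q, pt φt q⟫ - ∑ α, ∑ β, ⟪Ab α β (q.2 0) (pd β u q), pd α φt q⟫) = 0) :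
    Sol Ab u := by
  refine ⟨hu, ?_⟩
  set H : ℝ × Ed d → Em m := fun q => pt u q - ∑ α, pd α (flux Ab u α) q with hH
  have hHs : Continuous H := (pt_smooth hu).continuous.sub
    (continuous_finsetSum _ fun α _ => (pd_smooth (flux_smooth hA hu α) α).continuous)
  suffices hz : ∀ c : Em m, ∀ q ∈ Qc0 (d := d) 4, ⟪c, H q⟫ = 0 by
    intro q hq
    exact sub_eq_zero.1 (inner_self_eq_zero.1 (hz (H q) q hq))
  intro c
  have hcont : Continuous fun q => ⟪c, H q⟫ := continuous_const.inner hHs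
  have hae : ∀ᵐ q : ℝ × Ed d, q ∈ Qc0 (d := d) 4 → ⟪c, H q⟫ = 0 := by
    refine (isOpen_Qc0 4).ae_eq_zero_of_integral_contDiff_smul_eq_zero
      (hcont.locallyIntegrable.locallyIntegrableOn _) ?_
    intro g hg hgc hgs
    set φ : ℝ × Ed d → Em m := fun q => g q • c with hφd
    have hφ : ContDiff ℝ (⊤ : ℕ∞) φ := hg.smul contDiff_const
    have hc : HasCompactSupport φ := hgc.smul_right
    have hs : tsupport φ ⊆ Qc0 4 := (tsupport_smul_subset_left g _).trans hgs
    have e1 : ∀ q, g q • ⟪c, H q⟫ = ⟪φ q, pt u q⟫ - ∑ α, ⟪φ q, pd α (flux Ab u α) q⟫ := by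
      intro q
      simp only [hφd, hH, inner_sub_right, inner_sum, inner_smul_left, smul_eq_mul, mul_sub,
        Finset.mul_sum]
      simp
    simp_rw [e1]
    have i1 : ∀ α, Integrable fun q => ⟪φ q, pd α (flux Ab u α) q⟫ := fun α =>
      int_inner hφ.continuous hc (pd_smooth (flux_smooth hA hu α) α).continuous
    have i2 : ∀ α, Integrable fun q => ⟪pd α φ q, flux Ab u α q⟫ := fun α =>
      int_inner (pd_smooth hφ α).continuous (hcs_dd hc _) (flux_smooth hA hu α).continuous
    rw [integral_sub (int_inner hφ.continuous hc (pt_smooth hu).continuous)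
      (integrable_finsetSum _ fun α _ => i1 α), integral_finsetSum _ (fun α _ => i1 α)]
    have e2 := h φ hφ hc hs
    have e3 : ∀ q, ⟪u q, pt φ q⟫ - ∑ α, ∑ β, ⟪Ab α β (q.2 0) (pd β u q), pd α φ q⟫
        = ⟪pt φ q, u q⟫ - ∑ α, ⟪pd α φ q, flux Ab u α q⟫ := by
      intro q
      rw [real_inner_comm]
      congr 1
      refine Finset.sum_congr rfl fun α _ => ?_
      rw [flux, real_inner_comm, sum_inner]
    simp_rw [e3] at e2
    rw [integral_sub (int_inner (pt_smooth hφ).continuous (hcs_dd hc _) hu.continuous)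
      (integrable_finsetSum _ fun α _ => i2 α), integral_finsetSum _ (fun α _ => i2 α)] at e2
    have e4 : ∫ q, ⟪φ q, pt u q⟫ = - ∫ q, ⟪pt φ q, u q⟫ := ibp hφ hc hu _
    have e5 : ∀ α, ∫ q, ⟪φ q, pd α (flux Ab u α) q⟫ = - ∫ q, ⟪pd α φ q, flux Ab u α q⟫ :=
      fun α => ibp hφ hc (flux_smooth hA hu α) _
    rw [e4, Finset.sum_congr rfl fun α _ => e5 α, Finset.sum_neg_distrib]
    linarith
  have hae' : (fun q => ⟪c, H q⟫) =ᵐ[volume.restrict (Qc0 (d := d) 4)] fun _ => (0 : ℝ) :=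
    (ae_restrict_iff' (isOpen_Qc0 4).measurableSet).2 hae
  exact Measure.eqOn_open_of_ae_eq hae' (isOpen_Qc0 4) hcont.continuousOn continuousOn_const

/-- cutoff functions -/
structure Cut (K R : ℝ) (ζ : ℝ × Ed d → ℝ) : Prop where
  smooth : ContDiff ℝ (⊤ : ℕ∞) ζ
  cpt : HasCompactSupport ζ
  supp : tsupport ζ ⊆ Qc0 R
  nonneg : ∀ q, 0 ≤ ζ q
  le_one : ∀ q, ζ q ≤ 1
  pt_le : ∀ q, pt ζ q ≤ K
  pd_le : ∀ α q, |pd α ζ q| ≤ K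

lemma Cut.integrable {K R : ℝ} {ζ : ℝ × Ed d → ℝ} (hζ : Cut K R ζ) {g : ℝ × Ed d → ℝ}
    (hg : Continuous g) {n : ℕ} (hn : n ≠ 0) : Integrable fun q => ζ q ^ n * g q := by
  refine Continuous.integrable_of_hasCompactSupport ((hζ.smooth.continuous.pow n).mul hg) ?_
  exact hζ.cpt.mono fun q hq => by
    contrapose! hq
    have hq' : ζ q = 0 := by simpa using hq
    simp [hq', hn]

lemma dd_pow_smul {ζ : ℝ × Ed d → ℝ} (hζ : ContDiff ℝ (⊤ : ℕ∞) ζ) {v : ℝ × Ed d → Em m}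
    (hv : ContDiff ℝ (⊤ : ℕ∞) v) (n : ℕ) (e q : ℝ × Ed d) :
    dd e (fun q => ζ q ^ (n + 1) • v q) q
      = ζ q ^ (n + 1) • dd e v q + (((n + 1 : ℕ) : ℝ) * ζ q ^ n * dd e ζ q) • v q := by
  have h1 := ((smooth_diff hζ q).hasFDerivAt.pow (n + 1)).smul (smooth_diff hv q).hasFDerivAt
  have h2 := h1.fderiv
  unfold dd
  have h3 : (fun q => ζ q ^ (n + 1) • v q) = ((fun q => ζ q ^ (n + 1)) • v) := rfl
  rw [h3]
  erw [h2]
  simp [mul_assoc]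

end helpers2

section helpers3
variable {d m : ℕ}

/-- the sum of norms of the derivatives -/
def gradS (w : ℝ × Ed d → Em m) (q : ℝ × Ed d) : ℝ := ∑ α, ‖pd α w q‖

lemma gradS_nonneg (w : ℝ × Ed d → Em m) (q : ℝ × Ed d) : 0 ≤ gradS w q :=
  Finset.sum_nonneg fun _ _ => norm_nonneg _

lemma gradSq_nonneg (w : ℝ × Ed d → Em m) (q : ℝ × Ed d) : 0 ≤ gradSq w q :=
  Finset.sum_nonneg fun _ _ => by positivity

lemma gradS_sq (w : ℝ × Ed d → Em m) (q : ℝ × Ed d) : gradS w q ^ 2 ≤ d * gradSq w q := by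
  have := sq_sum_le_card_mul_sum_sq (s := (Finset.univ : Finset (Fin d))) (f := fun α => ‖pd α w q‖)
  simpa [gradS, gradSq] using this

lemma gradSq_cont {w : ℝ × Ed d → Em m} (hw : ContDiff ℝ (⊤ : ℕ∞) w) : Continuous (gradSq w) := by
  unfold gradSq
  exact continuous_finsetSum _ fun α _ => (pd_smooth hw α).continuous.norm.pow 2

lemma flux_norm [NeZero d] {δ : ℝ} {Ab : Fin d → Fin d → ℝ → CLM m}
    (hA : CoeffsOne δ Ab) (w : ℝ × Ed d → Em m) (α : Fin d) (q : ℝ × Ed d) :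
    ‖flux Ab w α q‖ ≤ δ⁻¹ * gradS w q := by
  unfold flux gradS
  rw [Finset.mul_sum]
  refine (norm_sum_le _ _).trans (Finset.sum_le_sum fun β _ => ?_)
  exact (ContinuousLinearMap.le_opNorm _ _).trans
    (mul_le_mul_of_nonneg_right ((hA.2 _).1 α β) (norm_nonneg _))

lemma flux_ell [NeZero d] {δ : ℝ} {Ab : Fin d → Fin d → ℝ → CLM m}
    (hA : CoeffsOne δ Ab) (w : ℝ × Ed d → Em m) (q : ℝ × Ed d) :
    δ * gradSq w q ≤ ∑ α, ⟪pd α w q, flux Ab w α q⟫ := by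
  have := (hA.2 (q.2 0)).2 (fun α => pd α w q)
  simpa [flux, gradSq, inner_sum] using this

/-- bound for the cutoff-derivative term -/
lemma cut_term [NeZero d] {δ K R : ℝ} (hδ : 0 < δ) (hK : 0 ≤ K) {Ab : Fin d → Fin d → ℝ → CLM m}
    (hA : CoeffsOne δ Ab) (w : ℝ × Ed d → Em m) (v : Em m) {ζ : ℝ × Ed d → ℝ}
    (hζ : Cut K R ζ) (n : ℕ) (q : ℝ × Ed d) :
    |∑ α, ⟪(((n + 1 : ℕ) : ℝ) * ζ q ^ n * pd α ζ q) • v, flux Ab w α q⟫|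
      ≤ ((n + 1 : ℕ) : ℝ) * K * d * δ⁻¹ * (ζ q ^ n * ‖v‖ * gradS w q) := by
  have hz := hζ.nonneg q
  calc |∑ α, ⟪(((n + 1 : ℕ) : ℝ) * ζ q ^ n * pd α ζ q) • v, flux Ab w α q⟫|
      ≤ ∑ α : Fin d, |⟪(((n + 1 : ℕ) : ℝ) * ζ q ^ n * pd α ζ q) • v, flux Ab w α q⟫| :=
        Finset.abs_sum_le_sum_abs _ _
    _ ≤ ∑ α : Fin d, ((n + 1 : ℕ) : ℝ) * ζ q ^ n * K * ‖v‖ * (δ⁻¹ * gradS w q) := by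
        refine Finset.sum_le_sum fun α _ => (abs_real_inner_le_norm _ _).trans ?_
        have h1 := flux_norm hA w α q
        rw [norm_smul, Real.norm_eq_abs, abs_mul, abs_of_nonneg (by positivity :
          0 ≤ ((n + 1 : ℕ) : ℝ) * ζ q ^ n)]
        have := hζ.pd_le α q
        gcongr
    _ = _ := by
        rw [Finset.sum_const, Finset.card_univ, Fintype.card_fin, nsmul_eq_mul]; ring

lemma tsupport_pow_smul {R : ℝ} {K : ℝ} {ζ : ℝ × Ed d → ℝ} (hζ : Cut K R ζ)
    (v : ℝ × Ed d → Em m) (n : ℕ) :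
    HasCompactSupport (fun q => ζ q ^ (n + 1) • v q) ∧
    tsupport (fun q => ζ q ^ (n + 1) • v q) ⊆ Qc0 R := by
  have hsub : Function.support (fun q => ζ q ^ (n + 1) • v q) ⊆ Function.support ζ := by
    intro q hq
    contrapose! hq
    have hq' : ζ q = 0 := by simpa using hq
    simp [hq']
  exact ⟨hζ.cpt.mono hsub, (closure_mono hsub).trans hζ.supp⟩

lemma Qc0_mono {r R : ℝ} (hr : 0 ≤ r) (h : r ≤ R) : Qc0 (d := d) r ⊆ Qc0 R := by
  unfold Qc0 Qc
  refine Set.prod_mono (Ioo_subset_Ioo ?_ le_rfl) (ball_subset_ball h)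
  have : r ^ 2 ≤ R ^ 2 := by gcongr
  linarith

/-- weighted Caccioppoli inequality -/
lemma cacc_w (d : ℕ) [NeZero d] (δ : ℝ) (hδ : 0 < δ) (K : ℝ) (hK : 0 ≤ K) (n : ℕ) :
    ∃ C : ℝ, 0 < C ∧ ∀ (m : ℕ) (Ab : Fin d → Fin d → ℝ → CLM m), CoeffsOne δ Ab →
      (∀ α β, ContDiff ℝ (⊤ : ℕ∞) (Ab α β)) → ∀ w : ℝ × Ed d → Em m, Sol Ab w →
      ∀ (R : ℝ) (ζ : ℝ × Ed d → ℝ), 0 ≤ R → R ≤ 4 → Cut K R ζ →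
      ∫ q, ζ q ^ (n + 3) * gradSq w q ≤ C * ∫ q, ζ q ^ (n + 1) * ‖w q‖ ^ 2 := by
  set B : ℝ := ((n + 3 : ℕ) : ℝ) * K * d * δ⁻¹ with hB
  have hd : (0 : ℝ) < d := by exact_mod_cast Nat.pos_of_ne_zero (NeZero.ne d)
  set C1 : ℝ := d * B ^ 2 / (2 * δ) + (n + 3) * K / 2 + 1 with hC1
  have hC1p : 0 < C1 := by positivity
  refine ⟨2 / δ * C1, by positivity, ?_⟩
  intro m Ab hA hAs w hw R ζ hR0 hR4 hζ
  have hφ : ContDiff ℝ (⊤ : ℕ∞) (fun q => ζ q ^ (n + 3) • w q) := (hζ.smooth.pow _).smul hw.1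
  obtain ⟨hc, hs⟩ := tsupport_pow_smul hζ w (n + 2)
  have id1 := test_identity hAs hw hφ hc (hs.trans (Qc0_mono hR0 hR4))
  have id2 : ∫ q, ⟪ζ q ^ (n + 3) • w q, pt w q⟫
      = - ∫ q, ⟪pt (fun q => ζ q ^ (n + 3) • w q) q, w q⟫ := ibp hφ hc hw.1 _
  have hflux : ∀ α, Integrable fun q => ⟪pd α (fun q => ζ q ^ (n + 3) • w q) q, flux Ab w α q⟫ :=
    fun α => int_inner (pd_smooth hφ α).continuous (hcs_dd hc _) (flux_smooth hAs hw.1 α).continuous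
  have hpt : Integrable fun q => ⟪pt (fun q => ζ q ^ (n + 3) • w q) q, w q⟫ :=
    int_inner (pt_smooth hφ).continuous (hcs_dd hc _) hw.1.continuous
  have hpt2 : Integrable fun q => ⟪ζ q ^ (n + 3) • w q, pt w q⟫ :=
    int_inner hφ.continuous hc (pt_smooth hw.1).continuous
  have hsum : Integrable fun q => ∑ α, ⟪pd α (fun q => ζ q ^ (n + 3) • w q) q, flux Ab w α q⟫ :=
    integrable_finsetSum _ fun α _ => hflux α
  have hdiff : Integrable fun q => ⟪pt (fun q => ζ q ^ (n + 3) • w q) q, w q⟫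
      - ⟪ζ q ^ (n + 3) • w q, pt w q⟫ := hpt.sub hpt2
  have hzero : ∫ q, (∑ α, ⟪pd α (fun q => ζ q ^ (n + 3) • w q) q, flux Ab w α q⟫
      - (1 / 2) * (⟪pt (fun q => ζ q ^ (n + 3) • w q) q, w q⟫
        - ⟪ζ q ^ (n + 3) • w q, pt w q⟫)) = 0 := by
    rw [integral_sub hsum (hdiff.const_mul _), integral_const_mul, integral_sub hpt hpt2]
    linarith
  have hlow : ∀ q, δ / 2 * (ζ q ^ (n + 3) * gradSq w q) - C1 * (ζ q ^ (n + 1) * ‖w q‖ ^ 2)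
      ≤ ∑ α, ⟪pd α (fun q => ζ q ^ (n + 3) • w q) q, flux Ab w α q⟫
      - (1 / 2) * (⟪pt (fun q => ζ q ^ (n + 3) • w q) q, w q⟫
        - ⟪ζ q ^ (n + 3) • w q, pt w q⟫) := by
    intro q
    have hz := hζ.nonneg q
    have hz1 := hζ.le_one q
    have e1 : ∑ α, ⟪pd α (fun q => ζ q ^ (n + 3) • w q) q, flux Ab w α q⟫
        = ζ q ^ (n + 3) * ∑ α, ⟪pd α w q, flux Ab w α q⟫
        + ∑ α, ⟪(((n + 2 + 1 : ℕ) : ℝ) * ζ q ^ (n + 2) * pd α ζ q) • w q, flux Ab w α q⟫ := by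
      rw [Finset.mul_sum, ← Finset.sum_add_distrib]
      refine Finset.sum_congr rfl fun α _ => ?_
      rw [pd_eq, dd_pow_smul hζ.smooth hw.1 (n + 2), inner_add_left, real_inner_smul_left]
      rfl
    have e2 : ⟪pt (fun q => ζ q ^ (n + 3) • w q) q, w q⟫ - ⟪ζ q ^ (n + 3) • w q, pt w q⟫
        = ((n + 2 + 1 : ℕ) : ℝ) * ζ q ^ (n + 2) * pt ζ q * ‖w q‖ ^ 2 := by
      rw [pt_eq, dd_pow_smul hζ.smooth hw.1 (n + 2), inner_add_left, real_inner_smul_left,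
        real_inner_smul_left, real_inner_smul_left, real_inner_self_eq_norm_sq, ← pt_eq, ← pt_eq,
        real_inner_comm (w q) (pt w q)]
      ring
    have t1 := (abs_le.1 (cut_term hδ hK hA w (w q) hζ (n + 2) q)).1
    have t2 := flux_ell hA w q
    have t3 : ζ q ^ (n + 3) * (δ * gradSq w q) ≤ ζ q ^ (n + 3) * ∑ α, ⟪pd α w q, flux Ab w α q⟫ :=
      mul_le_mul_of_nonneg_left t2 (by positivity)
    have t4 : ((n + 2 + 1 : ℕ) : ℝ) * ζ q ^ (n + 2) * pt ζ q * ‖w q‖ ^ 2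
        ≤ (n + 3) * K * (ζ q ^ (n + 1) * ‖w q‖ ^ 2) := by
      have a1 : ζ q ^ (n + 2) * pt ζ q ≤ ζ q ^ (n + 1) * K := by
        calc ζ q ^ (n + 2) * pt ζ q ≤ ζ q ^ (n + 2) * K :=
              mul_le_mul_of_nonneg_left (hζ.pt_le q) (by positivity)
          _ ≤ ζ q ^ (n + 1) * K :=
              mul_le_mul_of_nonneg_right (pow_le_pow_of_le_one hz hz1 (by omega)) hK
      have a2 : 0 ≤ ((n : ℝ) + 3) * ‖w q‖ ^ 2 := by positivity
      have := mul_le_mul_of_nonneg_left a1 a2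
      push_cast
      calc _ = ((n : ℝ) + 3) * ‖w q‖ ^ 2 * (ζ q ^ (n + 2) * pt ζ q) := by ring
        _ ≤ _ := this
        _ = _ := by ring
    have t5 : B * (ζ q ^ (n + 2) * ‖w q‖ * gradS w q)
        ≤ δ / 2 * (ζ q ^ (n + 3) * gradSq w q) + d * B ^ 2 / (2 * δ) * (ζ q ^ (n + 1) * ‖w q‖ ^ 2) := by
      have b1 : 0 ≤ ζ q ^ (n + 1) := by positivity
      have b2 : B * (ζ q * ‖w q‖ * gradS w q) ≤ δ / 2 * (ζ q ^ 2 * gradSq w q)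
          + d * B ^ 2 / (2 * δ) * ‖w q‖ ^ 2 := by
        have c1 : δ / (2 * d) * (ζ q ^ 2 * gradS w q ^ 2) ≤ δ / 2 * (ζ q ^ 2 * gradSq w q) := by
          calc _ ≤ δ / (2 * d) * (ζ q ^ 2 * (d * gradSq w q)) := by
                have := gradS_sq w q
                gcongr
            _ = _ := by field_simp
        have c2 : B * (ζ q * ‖w q‖ * gradS w q) ≤ δ / (2 * d) * (ζ q ^ 2 * gradS w q ^ 2)
            + d * B ^ 2 / (2 * δ) * ‖w q‖ ^ 2 := by
          have : δ / (2 * d) * (ζ q ^ 2 * gradS w q ^ 2) + d * B ^ 2 / (2 * δ) * ‖w q‖ ^ 2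
            - B * (ζ q * ‖w q‖ * gradS w q)
            = (2 * d * δ)⁻¹ * (δ * (ζ q * gradS w q) - d * B * ‖w q‖) ^ 2 := by
            field_simp
            ring
          have h0 : 0 ≤ (2 * d * δ)⁻¹ * (δ * (ζ q * gradS w q) - d * B * ‖w q‖) ^ 2 := by positivity
          linarith
        linarith
      have := mul_le_mul_of_nonneg_left b2 b1
      calc _ = ζ q ^ (n + 1) * (B * (ζ q * ‖w q‖ * gradS w q)) := by ring
        _ ≤ _ := this
        _ = _ := by ring
    have t1' : -(B * (ζ q ^ (n + 2) * ‖w q‖ * gradS w q)) ≤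
      ∑ α, ⟪(((n + 2 + 1 : ℕ) : ℝ) * ζ q ^ (n + 2) * pd α ζ q) • w q, flux Ab w α q⟫ := t1
    have t6 : 0 ≤ ζ q ^ (n + 1) * ‖w q‖ ^ 2 := by positivity
    rw [e1, e2, hC1]
    linarith
  have i1 : Integrable fun q => ζ q ^ (n + 3) * gradSq w q :=
    hζ.integrable (gradSq_cont hw.1) (by omega)
  have i2 : Integrable fun q => ζ q ^ (n + 1) * ‖w q‖ ^ 2 :=
    hζ.integrable (hw.1.continuous.norm.pow 2) (by omega)
  have hfin := integral_mono ((i1.const_mul (δ / 2)).sub (i2.const_mul C1))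
    (hsum.sub (hdiff.const_mul (1 / 2))) hlow
  have hfin2 : ∫ q, (δ / 2 * (ζ q ^ (n + 3) * gradSq w q) - C1 * (ζ q ^ (n + 1) * ‖w q‖ ^ 2)) ≤ 0 :=
    hfin.trans hzero.le
  rw [integral_sub (i1.const_mul _) (i2.const_mul _), integral_const_mul, integral_const_mul] at hfin2
  calc ∫ q, ζ q ^ (n + 3) * gradSq w q
      = 2 / δ * (δ / 2 * ∫ q, ζ q ^ (n + 3) * gradSq w q) := by field_simp
    _ ≤ 2 / δ * (C1 * ∫ q, ζ q ^ (n + 1) * ‖w q‖ ^ 2) := by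
        have : 0 ≤ 2 / δ := by positivity
        exact mul_le_mul_of_nonneg_left (by linarith) this
    _ = _ := by ring

/-- weighted bound for the time derivative -/
lemma time_w (d : ℕ) [NeZero d] (δ : ℝ) (hδ : 0 < δ) (K : ℝ) (hK : 0 ≤ K) :
    ∃ C : ℝ, 0 < C ∧ ∀ (m : ℕ) (Ab : Fin d → Fin d → ℝ → CLM m), CoeffsOne δ Ab →
      (∀ α β, ContDiff ℝ (⊤ : ℕ∞) (Ab α β)) → ∀ w : ℝ × Ed d → Em m, Sol Ab w →
      ∀ (R : ℝ) (ζ : ℝ × Ed d → ℝ), 0 ≤ R → R ≤ 4 → Cut K R ζ →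
      ∫ q, ζ q ^ 4 * ‖pt w q‖ ^ 2 ≤ C * ∫ q, ζ q ^ 2 * gradSq w q := by
  obtain ⟨C0, hC0, hcacc⟩ := cacc_w d δ hδ K hK 3
  have hd : (0 : ℝ) < d := by exact_mod_cast Nat.pos_of_ne_zero (NeZero.ne d)
  set η : ℝ := 1 / (4 * d * C0) with hη
  have hηp : 0 < η := by positivity
  set B : ℝ := ((3 + 1 : ℕ) : ℝ) * K * d * δ⁻¹ with hB
  set C1 : ℝ := B ^ 2 * d + d * (δ⁻¹) ^ 2 / (4 * η) + 1 with hC1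
  have hC1p : 0 < C1 := by positivity
  refine ⟨2 * C1, by positivity, ?_⟩
  intro m Ab hA hAs w hw R ζ hR0 hR4 hζ
  have hvS : Sol Ab (pt w) := hw.dd hAs (by simp)
  have hv := hvS.1
  have hcac := hcacc m Ab hA hAs (pt w) hvS R ζ hR0 hR4 hζ
  have hφ : ContDiff ℝ (⊤ : ℕ∞) (fun q => ζ q ^ 4 • pt w q) := (hζ.smooth.pow _).smul hv
  obtain ⟨hc, hs⟩ := tsupport_pow_smul hζ (pt w) 3
  have id1 := test_identity hAs hw hφ hc (hs.trans (Qc0_mono hR0 hR4))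
  have hsum : Integrable fun q => ∑ α, ⟪pd α (fun q => ζ q ^ 4 • pt w q) q, flux Ab w α q⟫ :=
    integrable_finsetSum _ fun α _ => int_inner (pd_smooth hφ α).continuous (hcs_dd hc _)
      (flux_smooth hAs hw.1 α).continuous
  have i1 : Integrable fun q => ζ q ^ 4 * ‖pt w q‖ ^ 2 :=
    hζ.integrable (hv.continuous.norm.pow 2) (by omega)
  have i2 : Integrable fun q => ζ q ^ 6 * gradSq (pt w) q :=
    hζ.integrable (gradSq_cont hv) (by omega)
  have i3 : Integrable fun q => ζ q ^ 2 * gradSq w q :=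
    hζ.integrable (gradSq_cont hw.1) (by omega)
  have e0 : ∀ q, ⟪ζ q ^ 4 • pt w q, pt w q⟫ = ζ q ^ 4 * ‖pt w q‖ ^ 2 := by
    intro q; rw [real_inner_smul_left, real_inner_self_eq_norm_sq]
  simp_rw [e0] at id1
  rw [← integral_neg] at id1
  have hup : ∀ q, - ∑ α, ⟪pd α (fun q => ζ q ^ 4 • pt w q) q, flux Ab w α q⟫
      ≤ (1 / 4) * (ζ q ^ 4 * ‖pt w q‖ ^ 2) + η * d * (ζ q ^ 6 * gradSq (pt w) q)
        + C1 * (ζ q ^ 2 * gradSq w q) := by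
    intro q
    have hz := hζ.nonneg q
    have e1 : ∑ α, ⟪pd α (fun q => ζ q ^ 4 • pt w q) q, flux Ab w α q⟫
        = ζ q ^ 4 * ∑ α, ⟪pd α (pt w) q, flux Ab w α q⟫
        + ∑ α, ⟪(((3 + 1 : ℕ) : ℝ) * ζ q ^ 3 * pd α ζ q) • pt w q, flux Ab w α q⟫ := by
      rw [Finset.mul_sum, ← Finset.sum_add_distrib]
      refine Finset.sum_congr rfl fun α _ => ?_
      rw [pd_eq, dd_pow_smul hζ.smooth hv 3, inner_add_left, real_inner_smul_left]
      rfl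
    have t1 : -(B * (ζ q ^ 3 * ‖pt w q‖ * gradS w q)) ≤
      ∑ α, ⟪(((3 + 1 : ℕ) : ℝ) * ζ q ^ 3 * pd α ζ q) • pt w q, flux Ab w α q⟫ :=
      (abs_le.1 (cut_term hδ hK hA w (pt w q) hζ 3 q)).1
    have t2 : -(gradS (pt w) q * (δ⁻¹ * gradS w q)) ≤ ∑ α, ⟪pd α (pt w) q, flux Ab w α q⟫ := by
      refine (abs_le.1 ?_).1
      refine (Finset.abs_sum_le_sum_abs _ _).trans ?_
      conv_rhs => rw [gradS, Finset.sum_mul]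
      refine Finset.sum_le_sum fun α _ => (abs_real_inner_le_norm _ _).trans ?_
      exact mul_le_mul_of_nonneg_left (flux_norm hA w α q) (norm_nonneg _)
    have t3 := mul_le_mul_of_nonneg_left t2 (by positivity : 0 ≤ ζ q ^ 4)
    have s1 := gradS_sq w q
    have s2 := gradS_sq (pt w) q
    have t4 : B * (ζ q ^ 3 * ‖pt w q‖ * gradS w q)
        ≤ (1 / 4) * (ζ q ^ 4 * ‖pt w q‖ ^ 2) + B ^ 2 * d * (ζ q ^ 2 * gradSq w q) := by
      have c1 : B ^ 2 * (ζ q ^ 2 * gradS w q ^ 2) ≤ B ^ 2 * (ζ q ^ 2 * (d * gradSq w q)) := by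
        gcongr
      have c2 := sq_nonneg ((1 / 2) * (ζ q ^ 2 * ‖pt w q‖) - B * (ζ q * gradS w q))
      nlinarith
    have t5 : ζ q ^ 4 * (gradS (pt w) q * (δ⁻¹ * gradS w q))
        ≤ η * d * (ζ q ^ 6 * gradSq (pt w) q)
          + d * (δ⁻¹) ^ 2 / (4 * η) * (ζ q ^ 2 * gradSq w q) := by
      have c1 : η * (ζ q ^ 6 * gradS (pt w) q ^ 2) ≤ η * (ζ q ^ 6 * (d * gradSq (pt w) q)) := by
        gcongr
      have c2 : (δ⁻¹) ^ 2 / (4 * η) * (ζ q ^ 2 * gradS w q ^ 2)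
          ≤ (δ⁻¹) ^ 2 / (4 * η) * (ζ q ^ 2 * (d * gradSq w q)) := by
        gcongr
      have c3 : η * (ζ q ^ 6 * gradS (pt w) q ^ 2)
          + (δ⁻¹) ^ 2 / (4 * η) * (ζ q ^ 2 * gradS w q ^ 2)
          - ζ q ^ 4 * (gradS (pt w) q * (δ⁻¹ * gradS w q))
          = (4 * η)⁻¹ * (2 * η * (ζ q ^ 3 * gradS (pt w) q) - δ⁻¹ * (ζ q * gradS w q)) ^ 2 := by
        field_simp
        ring
      have c4 : 0 ≤ (4 * η)⁻¹ *
        (2 * η * (ζ q ^ 3 * gradS (pt w) q) - δ⁻¹ * (ζ q * gradS w q)) ^ 2 := by positivity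
      calc _ ≤ η * (ζ q ^ 6 * (d * gradSq (pt w) q))
          + (δ⁻¹) ^ 2 / (4 * η) * (ζ q ^ 2 * (d * gradSq w q)) := by linarith
        _ = _ := by ring
    have t6 : 0 ≤ ζ q ^ 2 * gradSq w q := mul_nonneg (by positivity) (gradSq_nonneg w q)
    have t7 : C1 * (ζ q ^ 2 * gradSq w q) = B ^ 2 * d * (ζ q ^ 2 * gradSq w q)
        + d * (δ⁻¹) ^ 2 / (4 * η) * (ζ q ^ 2 * gradSq w q) + ζ q ^ 2 * gradSq w q := by
      rw [hC1]; ring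
    rw [mul_neg] at t3
    rw [e1, t7, neg_add]
    exact (add_le_add ((neg_le.1 t3).trans t5) ((neg_le.1 t1).trans t4)).trans (by linarith)
  have i12 : Integrable fun q => (1 / 4) * (ζ q ^ 4 * ‖pt w q‖ ^ 2)
      + η * d * (ζ q ^ 6 * gradSq (pt w) q) := (i1.const_mul (1 / 4)).add (i2.const_mul (η * d))
  have hfin := integral_mono hsum.neg (i12.add (i3.const_mul C1)) hup
  simp only [Pi.neg_apply, Pi.add_apply] at hfin
  rw [integral_add i12 (i3.const_mul C1),
    integral_add (i1.const_mul (1 / 4)) (i2.const_mul (η * d)), integral_const_mul,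
    integral_const_mul, integral_const_mul, ← id1] at hfin
  have hx : η * d * ∫ q, ζ q ^ 6 * gradSq (pt w) q ≤ (1 / 4) * ∫ q, ζ q ^ 4 * ‖pt w q‖ ^ 2 := by
    calc η * d * ∫ q, ζ q ^ 6 * gradSq (pt w) q
        ≤ η * d * (C0 * ∫ q, ζ q ^ 4 * ‖pt w q‖ ^ 2) :=
          mul_le_mul_of_nonneg_left hcac (by positivity)
      _ = _ := by rw [hη]; field_simp
  linarith

end helpers3

section helpers4
variable {d m : ℕ}

lemma smoothTransition_deriv_bound : ∃ M : ℝ, 0 ≤ M ∧ ∀ x, deriv Real.smoothTransition x ≤ M := by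
  have hc : HasCompactSupport (deriv Real.smoothTransition) := by
    refine HasCompactSupport.intro (isCompact_Icc (a := (0 : ℝ)) (b := 1)) fun x hx => ?_
    rcases lt_or_ge x 0 with h | h
    · have : Real.smoothTransition =ᶠ[nhds x] fun _ => (0 : ℝ) := by
        filter_upwards [Iio_mem_nhds h] with y hy
        exact Real.smoothTransition.zero_of_nonpos (le_of_lt hy)
      rw [this.deriv_eq]; simp
    · have h1 : 1 < x := by
        by_contra h2
        exact hx ⟨h, not_lt.1 h2⟩
      have : Real.smoothTransition =ᶠ[nhds x] fun _ => (1 : ℝ) := by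
        filter_upwards [Ioi_mem_nhds h1] with y hy
        exact Real.smoothTransition.one_of_one_le (le_of_lt hy)
      rw [this.deriv_eq]; simp
  have hcont : Continuous (deriv Real.smoothTransition) :=
    (Real.smoothTransition.contDiff (n := 1)).continuous_deriv (by simp)
  obtain ⟨M, hM⟩ := hc.exists_bound_of_continuous hcont
  exact ⟨M, (norm_nonneg _).trans (hM 0), fun x => (le_abs_self _).trans (hM x)⟩

lemma exists_cut (d : ℕ) {r R : ℝ} (hr : 0 < r) (hrR : r < R) :
    ∃ K : ℝ, 0 ≤ K ∧ ∀ s : ℝ, 0 < s → ∃ ζ : ℝ × Ed d → ℝ, Cut K R ζ ∧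
      ∀ q ∈ Ioo (-r ^ 2) (-s) ×ˢ ball (0 : Ed d) r, ζ q = 1 := by
  obtain ⟨M, hM0, hM⟩ := smoothTransition_deriv_bound
  set ρ : ℝ := (r + R) / 2 with hρ
  have hrρ : r < ρ := by rw [hρ]; linarith
  have hρR : ρ < R := by rw [hρ]; linarith
  let f : ContDiffBump (0 : Ed d) := ⟨r, ρ, hr, hrρ⟩
  have hfs : ContDiff ℝ (⊤ : ℕ∞) f := f.contDiff
  have hfd : Differentiable ℝ f := hfs.differentiable (by simp)
  obtain ⟨M2, hM2⟩ := (f.hasCompactSupport.fderiv (𝕜 := ℝ)).exists_bound_of_continuous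
    (hfs.continuous_fderiv (by simp))
  have hM20 : 0 ≤ M2 := (norm_nonneg _).trans (hM2 0)
  have hsq : 0 < ρ ^ 2 - r ^ 2 := by nlinarith
  have hsq2 : ρ ^ 2 < R ^ 2 := by nlinarith
  set c : ℝ := (ρ ^ 2 - r ^ 2)⁻¹ with hc
  have hc0 : 0 < c := by positivity
  refine ⟨M * c + M2, by positivity, fun s hs => ?_⟩
  set T := Real.smoothTransition with hT
  have hTs : ContDiff ℝ (⊤ : ℕ∞) T := Real.smoothTransition.contDiff
  have hTd : Differentiable ℝ T := hTs.differentiable (by simp)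
  have hT0 : ∀ x, 0 ≤ T x := Real.smoothTransition.nonneg
  have hT1 : ∀ x, T x ≤ 1 := Real.smoothTransition.le_one
  have hTmono : ∀ x, 0 ≤ deriv T x := fun x => Real.smoothTransition.monotone.deriv_nonneg
  let a : ℝ → ℝ := fun t => T (c * (t + ρ ^ 2)) * T (-(2 / s) * (t + s / 2))
  have has : ContDiff ℝ (⊤ : ℕ∞) a :=
    (hTs.comp (contDiff_const.mul (contDiff_id.add contDiff_const))).mul
      (hTs.comp (contDiff_const.mul (contDiff_id.add contDiff_const)))
  have ha0 : ∀ t, 0 ≤ a t := fun t => mul_nonneg (hT0 _) (hT0 _)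
  have ha1 : ∀ t, a t ≤ 1 := fun t => mul_le_one₀ (hT1 _) (hT0 _) (hT1 _)
  have had : ∀ t, deriv a t ≤ M * c := by
    intro t
    have l1 : HasDerivAt (fun t : ℝ => c * (t + ρ ^ 2)) c t := by
      simpa using ((hasDerivAt_id t).add_const (ρ ^ 2)).const_mul c
    have l2 : HasDerivAt (fun t : ℝ => -(2 / s) * (t + s / 2)) (-(2 / s)) t := by
      simpa using ((hasDerivAt_id t).add_const (s / 2)).const_mul (-(2 / s))
    have h1 := (hTd (c * (t + ρ ^ 2))).hasDerivAt.comp t l1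
    have h2 := (hTd (-(2 / s) * (t + s / 2))).hasDerivAt.comp t l2
    have h3 : deriv a t = _ := (h1.mul h2).deriv
    rw [h3]
    simp only [Function.comp]
    have k1 : deriv T (c * (t + ρ ^ 2)) * c * T (-(2 / s) * (t + s / 2)) ≤ M * c := by
      calc _ ≤ M * c * 1 := by
            have := hM (c * (t + ρ ^ 2))
            have := hT1 (-(2 / s) * (t + s / 2))
            have := hT0 (-(2 / s) * (t + s / 2))
            gcongr
        _ = _ := by ring
    have k2 : 0 ≤ T (c * (t + ρ ^ 2)) * (deriv T (-(2 / s) * (t + s / 2)) * (2 / s)) :=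
      mul_nonneg (hT0 _) (mul_nonneg (hTmono _) (by positivity))
    linarith
  let ζ : ℝ × Ed d → ℝ := fun q => a q.1 * f q.2
  have hder : ∀ q e : ℝ × Ed d, fderiv ℝ ζ q e = a q.1 * fderiv ℝ f q.2 e.2
      + deriv a q.1 * e.1 * f q.2 := by
    intro q e
    have h1 : HasFDerivAt (fun q : ℝ × Ed d => a q.1) _ q :=
      ((has.differentiable (by simp)) q.1).hasDerivAt.comp_hasFDerivAt q
        (ContinuousLinearMap.fst ℝ ℝ (Ed d)).hasFDerivAt
    have h2 : HasFDerivAt (fun q : ℝ × Ed d => f q.2) _ q :=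
      (hfd q.2).hasFDerivAt.comp q (ContinuousLinearMap.snd ℝ ℝ (Ed d)).hasFDerivAt
    have h3 : fderiv ℝ ζ q = _ := (h1.mul h2).fderiv
    rw [h3]
    simp
    ring
  have hsupp : Function.support ζ ⊆ Icc (-ρ ^ 2) (-(s / 2)) ×ˢ closedBall (0 : Ed d) ρ := by
    intro q hq
    have hq' : a q.1 * f q.2 ≠ 0 := hq
    have hqa := left_ne_zero_of_mul hq'
    have hqf := right_ne_zero_of_mul hq'
    have hqT1 : T (c * (q.1 + ρ ^ 2)) ≠ 0 := left_ne_zero_of_mul hqa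
    have hqT2 : T (-(2 / s) * (q.1 + s / 2)) ≠ 0 := right_ne_zero_of_mul hqa
    refine ⟨⟨?_, ?_⟩, ?_⟩
    · by_contra h
      refine hqT1 (Real.smoothTransition.zero_of_nonpos ?_)
      have : q.1 + ρ ^ 2 ≤ 0 := by push Not at h; linarith
      exact mul_nonpos_of_nonneg_of_nonpos hc0.le this
    · by_contra h
      refine hqT2 (Real.smoothTransition.zero_of_nonpos ?_)
      have h1 : 0 ≤ q.1 + s / 2 := by push Not at h; linarith
      have h2 : 0 ≤ 2 / s := by positivity
      have := mul_nonneg h2 h1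
      linarith
    · have h1 : q.2 ∈ Function.support f := hqf
      rw [f.support_eq] at h1
      exact ball_subset_closedBall h1
  have hcpt : IsCompact (Icc (-ρ ^ 2) (-(s / 2)) ×ˢ closedBall (0 : Ed d) ρ) :=
    isCompact_Icc.prod (isCompact_closedBall _ _)
  refine ⟨ζ, ⟨?_, ?_, ?_, ?_, ?_, ?_, ?_⟩, ?_⟩
  · exact (has.comp contDiff_fst).mul (hfs.comp contDiff_snd)
  · exact HasCompactSupport.of_support_subset_isCompact hcpt hsupp
  · refine (closure_minimal hsupp hcpt.isClosed).trans ?_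
    unfold Qc0 Qc
    refine Set.prod_mono (fun t ht => ⟨?_, ?_⟩) (closedBall_subset_ball hρR)
    · have := ht.1; linarith
    · have := ht.2; linarith
  · exact fun q => mul_nonneg (ha0 _) f.nonneg
  · exact fun q => mul_le_one₀ (ha1 _) f.nonneg f.le_one
  · intro q
    unfold pt
    rw [hder]
    simp only [map_zero, mul_zero, zero_add, mul_one]
    calc deriv a q.1 * f q.2 ≤ M * c * 1 := by
          have h1 := had q.1
          have h2 : 0 ≤ f q.2 := f.nonneg
          have h3 : f q.2 ≤ 1 := f.le_one
          calc _ ≤ M * c * f q.2 := mul_le_mul_of_nonneg_right h1 h2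
            _ ≤ _ := mul_le_mul_of_nonneg_left h3 (by positivity)
      _ ≤ _ := by linarith
  · intro α q
    unfold pd
    rw [hder]
    simp only [mul_zero, zero_mul, add_zero]
    have h1 : |fderiv ℝ f q.2 (EuclideanSpace.single α 1)| ≤ M2 := by
      have := (fderiv ℝ f q.2).le_opNorm (EuclideanSpace.single α 1)
      rw [EuclideanSpace.norm_single, norm_one, mul_one] at this
      exact this.trans (hM2 _)
    rw [abs_mul, abs_of_nonneg (ha0 _)]
    have h2 : a q.1 * |fderiv ℝ f q.2 (EuclideanSpace.single α 1)| ≤ 1 * M2 :=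
      mul_le_mul (ha1 _) h1 (abs_nonneg _) zero_le_one
    have h3 : 0 ≤ M * c := by positivity
    linarith
  · rintro q ⟨⟨h1, h2⟩, h3⟩
    have e1 : T (c * (q.1 + ρ ^ 2)) = 1 := by
      refine Real.smoothTransition.one_of_one_le ?_
      rw [hc, inv_mul_eq_div, le_div_iff₀ hsq]
      linarith
    have e2 : T (-(2 / s) * (q.1 + s / 2)) = 1 := by
      refine Real.smoothTransition.one_of_one_le ?_
      have : -(2 / s) * (q.1 + s / 2) = (-(2 * q.1) - s) / s := by field_simp; ring
      rw [this, le_div_iff₀ hs]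
      linarith
    have e3 : f q.2 = 1 := f.one_of_mem_closedBall (ball_subset_closedBall h3)
    change T (c * (q.1 + ρ ^ 2)) * T (-(2 / s) * (q.1 + s / 2)) * f q.2 = 1
    rw [e1, e2, e3]; norm_num

lemma integrableOn_Qc0 {f : ℝ × Ed d → ℝ} (hf : Continuous f) (r : ℝ) :
    IntegrableOn f (Qc0 (d := d) r) := by
  have h : IsCompact (Icc (0 - r ^ 2) 0 ×ˢ closedBall (0 : Ed d) r) :=
    isCompact_Icc.prod (isCompact_closedBall _ _)
  exact (hf.continuousOn.integrableOn_compact h).mono_set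
    (Set.prod_mono Ioo_subset_Icc_self ball_subset_closedBall)

lemma limit_Qc0 {f : ℝ × Ed d → ℝ} (hf : Continuous f) {r M : ℝ}
    (h : ∀ s : ℝ, 0 < s → ∫ q in Ioo (-r ^ 2) (-s) ×ˢ ball (0 : Ed d) r, f q ≤ M) :
    ∫ q in Qc0 (d := d) r, f q ≤ M := by
  let S : ℕ → Set (ℝ × Ed d) := fun n => Ioo (-r ^ 2) (-(1 / ((n : ℝ) + 1))) ×ˢ ball (0 : Ed d) r
  have hU : ⋃ n, S n = Qc0 (d := d) r := by
    ext q
    simp only [S, mem_iUnion, Qc0, Qc, Set.mem_prod, mem_Ioo, zero_sub]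
    constructor
    · rintro ⟨n, ⟨h1, h2⟩, h3⟩
      have : 0 < 1 / ((n : ℝ) + 1) := by positivity
      exact ⟨⟨h1, by linarith⟩, h3⟩
    · rintro ⟨⟨h1, h2⟩, h3⟩
      obtain ⟨n, hn⟩ := exists_nat_one_div_lt (show 0 < -q.1 by linarith)
      exact ⟨n, ⟨h1, by linarith⟩, h3⟩
  have hmono : Monotone S := by
    intro n k hnk
    refine Set.prod_mono (Ioo_subset_Ioo le_rfl ?_) subset_rfl
    have : 1 / ((k : ℝ) + 1) ≤ 1 / ((n : ℝ) + 1) := by gcongr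
    linarith
  have ht := tendsto_setIntegral_of_monotone (μ := (volume : Measure (ℝ × Ed d))) (f := f) (s := S)
    (fun n => measurableSet_Ioo.prod measurableSet_ball) hmono (by
      rw [hU]; exact integrableOn_Qc0 hf r)
  rw [hU] at ht
  exact le_of_tendsto' ht fun n => h _ (by positivity)

lemma cut_lower {K R r s : ℝ} {ζ : ℝ × Ed d → ℝ} (hζ : Cut K R ζ)
    (h1 : ∀ q ∈ Ioo (-r ^ 2) (-s) ×ˢ ball (0 : Ed d) r, ζ q = 1)
    {f : ℝ × Ed d → ℝ} (hf : Continuous f) (hf0 : ∀ q, 0 ≤ f q) {n : ℕ} (hn : n ≠ 0) :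
    ∫ q in Ioo (-r ^ 2) (-s) ×ˢ ball (0 : Ed d) r, f q ≤ ∫ q, ζ q ^ n * f q := by
  have hm : MeasurableSet (Ioo (-r ^ 2) (-s) ×ˢ ball (0 : Ed d) r) :=
    measurableSet_Ioo.prod measurableSet_ball
  calc _ = ∫ q in Ioo (-r ^ 2) (-s) ×ˢ ball (0 : Ed d) r, ζ q ^ n * f q :=
        setIntegral_congr_fun hm fun q hq => by simp [h1 q hq]
    _ ≤ _ := setIntegral_le_integral (hζ.integrable hf hn)
        (Filter.Eventually.of_forall fun q => mul_nonneg (pow_nonneg (hζ.nonneg q) _) (hf0 q))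

lemma cut_upper {K R : ℝ} {ζ : ℝ × Ed d → ℝ} (hζ : Cut K R ζ)
    {f : ℝ × Ed d → ℝ} (hf : Continuous f) (hf0 : ∀ q, 0 ≤ f q) {n : ℕ} (hn : n ≠ 0) :
    ∫ q, ζ q ^ n * f q ≤ ∫ q in Qc0 (d := d) R, f q := by
  rw [← integral_indicator (isOpen_Qc0 R).measurableSet]
  refine integral_mono (hζ.integrable hf hn)
    ((integrableOn_Qc0 hf R).integrable_indicator (isOpen_Qc0 R).measurableSet) fun q => ?_
  by_cases hq : q ∈ Qc0 (d := d) R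
  · rw [indicator_of_mem hq]
    exact mul_le_of_le_one_left (hf0 q) (pow_le_one₀ (hζ.nonneg q) (hζ.le_one q))
  · rw [indicator_of_notMem hq]
    have : ζ q = 0 := image_eq_zero_of_notMem_tsupport fun h => hq (hζ.supp h)
    simp [this, hn]

lemma cacc (d : ℕ) [NeZero d] (δ : ℝ) (hδ : 0 < δ) {r R : ℝ} (hr : 0 < r) (hrR : r < R)
    (hR : R ≤ 4) :
    ∃ C : ℝ, 0 < C ∧ ∀ (m : ℕ) (Ab : Fin d → Fin d → ℝ → CLM m), CoeffsOne δ Ab →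
      (∀ α β, ContDiff ℝ (⊤ : ℕ∞) (Ab α β)) → ∀ w : ℝ × Ed d → Em m, Sol Ab w →
      ∫ q in Qc0 (d := d) r, gradSq w q ≤ C * ∫ q in Qc0 (d := d) R, ‖w q‖ ^ 2 := by
  obtain ⟨K, hK, hcut⟩ := exists_cut d hr hrR
  obtain ⟨C, hC, h⟩ := cacc_w d δ hδ K hK 0
  refine ⟨C, hC, fun m Ab hA hAs w hw => limit_Qc0 (gradSq_cont hw.1) fun s hs => ?_⟩
  obtain ⟨ζ, hζ, hζ1⟩ := hcut s hs
  refine (cut_lower hζ hζ1 (gradSq_cont hw.1) (gradSq_nonneg w) (n := 0 + 3) (by norm_num)).trans ?_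
  refine (h m Ab hA hAs w hw R ζ (hr.trans hrR).le hR hζ).trans ?_
  exact mul_le_mul_of_nonneg_left (cut_upper hζ (hw.1.continuous.norm.pow 2)
    (fun q => sq_nonneg _) (by norm_num)) hC.le

lemma time_est (d : ℕ) [NeZero d] (δ : ℝ) (hδ : 0 < δ) {r R : ℝ} (hr : 0 < r) (hrR : r < R)
    (hR : R ≤ 4) :
    ∃ C : ℝ, 0 < C ∧ ∀ (m : ℕ) (Ab : Fin d → Fin d → ℝ → CLM m), CoeffsOne δ Ab →
      (∀ α β, ContDiff ℝ (⊤ : ℕ∞) (Ab α β)) → ∀ w : ℝ × Ed d → Em m, Sol Ab w →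
      ∫ q in Qc0 (d := d) r, ‖pt w q‖ ^ 2 ≤ C * ∫ q in Qc0 (d := d) R, gradSq w q := by
  obtain ⟨K, hK, hcut⟩ := exists_cut d hr hrR
  obtain ⟨C, hC, h⟩ := time_w d δ hδ K hK
  refine ⟨C, hC, fun m Ab hA hAs w hw =>
    limit_Qc0 ((pt_smooth hw.1).continuous.norm.pow 2) fun s hs => ?_⟩
  obtain ⟨ζ, hζ, hζ1⟩ := hcut s hs
  refine (cut_lower hζ hζ1 ((pt_smooth hw.1).continuous.norm.pow 2) (fun q => sq_nonneg _)
    (n := 4) (by norm_num)).trans ?_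
  refine (h m Ab hA hAs w hw R ζ (hr.trans hrR).le hR hζ).trans ?_
  exact mul_le_mul_of_nonneg_left (cut_upper hζ (gradSq_cont hw.1) (gradSq_nonneg w)
    (by norm_num)) hC.le

end helpers4

section helpers5
variable {d m : ℕ}

/-- admissible tangential directions -/
def Good [NeZero d] (e : ℝ × Ed d) : Prop :=
  e = (1, 0) ∨ ∃ k : Fin d, k ≠ 0 ∧ e = (0, EuclideanSpace.single k 1)

lemma Good.tan [NeZero d] {e : ℝ × Ed d} (he : Good e) : e.2 0 = 0 := by
  rcases he with rfl | ⟨k, hk, rfl⟩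
  · simp
  · simp [hk.symm]

lemma pd_sq_le (w : ℝ × Ed d → Em m) (k : Fin d) (q : ℝ × Ed d) :
    ‖pd k w q‖ ^ 2 ≤ gradSq w q :=
  Finset.single_le_sum (f := fun α => ‖pd α w q‖ ^ 2) (fun _ _ => sq_nonneg _) (Finset.mem_univ k)

lemma Qc0_int_mono {f g : ℝ × Ed d → ℝ} (hf : Continuous f) (hg : Continuous g) (r : ℝ)
    (h : ∀ q ∈ Qc0 (d := d) r, f q ≤ g q) :
    ∫ q in Qc0 (d := d) r, f q ≤ ∫ q in Qc0 (d := d) r, g q :=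
  setIntegral_mono_on (integrableOn_Qc0 hf r) (integrableOn_Qc0 hg r)
    (isOpen_Qc0 r).measurableSet h

lemma Qc0_set_mono {f : ℝ × Ed d → ℝ} (hf : Continuous f) (hf0 : ∀ q, 0 ≤ f q) {r R : ℝ}
    (hr : 0 ≤ r) (h : r ≤ R) :
    ∫ q in Qc0 (d := d) r, f q ≤ ∫ q in Qc0 (d := d) R, f q :=
  setIntegral_mono_set (integrableOn_Qc0 hf R) (Filter.Eventually.of_forall hf0)
    (Filter.Eventually.of_forall (Qc0_mono hr h))

lemma step_est (d : ℕ) [NeZero d] (δ : ℝ) (hδ : 0 < δ) {r R : ℝ} (hr : 0 < r) (hrR : r < R)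
    (hR : R ≤ 4) :
    ∃ C : ℝ, 0 < C ∧ ∀ (m : ℕ) (Ab : Fin d → Fin d → ℝ → CLM m), CoeffsOne δ Ab →
      (∀ α β, ContDiff ℝ (⊤ : ℕ∞) (Ab α β)) → ∀ w : ℝ × Ed d → Em m, Sol Ab w →
      ∀ e : ℝ × Ed d, Good e →
      ∫ q in Qc0 (d := d) r, gradSq (dd e w) q ≤ C * ∫ q in Qc0 (d := d) R, gradSq w q := by
  set ρ : ℝ := (r + R) / 2 with hρ
  have hrρ : r < ρ := by rw [hρ]; linarith
  have hρR : ρ < R := by rw [hρ]; linarith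
  obtain ⟨C1, hC1, h1⟩ := cacc d δ hδ hr hrρ (hρR.le.trans hR)
  obtain ⟨C2, hC2, h2⟩ := time_est d δ hδ (hr.trans hrρ) hρR hR
  refine ⟨C1 * (C2 + 1), by positivity, fun m Ab hA hAs w hw e he => ?_⟩
  have hc := h1 m Ab hA hAs (dd e w) (hw.dd hAs he.tan)
  have hI : 0 ≤ ∫ q in Qc0 (d := d) R, gradSq w q :=
    setIntegral_nonneg (isOpen_Qc0 R).measurableSet fun q _ => gradSq_nonneg w q
  refine hc.trans ?_
  rw [mul_assoc]
  refine mul_le_mul_of_nonneg_left ?_ hC1.le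
  rcases he with rfl | ⟨k, hk, rfl⟩
  · have := h2 m Ab hA hAs w hw
    rw [pt_eq] at this
    linarith
  · have a1 : ∫ q in Qc0 (d := d) ρ, ‖dd (0, EuclideanSpace.single k 1) w q‖ ^ 2
        ≤ ∫ q in Qc0 (d := d) ρ, gradSq w q :=
      Qc0_int_mono (((pd_smooth hw.1 k).continuous.norm).pow 2) (gradSq_cont hw.1) ρ
        (fun q _ => pd_sq_le w k q)
    have a2 := Qc0_set_mono (gradSq_cont hw.1) (gradSq_nonneg w) (hr.trans hrρ).le hρR.le
    have a3 := mul_nonneg hC2.le hI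
    linarith

lemma iter_est (d : ℕ) [NeZero d] (δ : ℝ) (hδ : 0 < δ) {r : ℝ} (hr : 0 < r) (n : ℕ) :
    ∀ R : ℝ, r < R → R ≤ 4 →
    ∃ C : ℝ, 0 < C ∧ ∀ (m : ℕ) (Ab : Fin d → Fin d → ℝ → CLM m), CoeffsOne δ Ab →
      (∀ α β, ContDiff ℝ (⊤ : ℕ∞) (Ab α β)) → ∀ w : ℝ × Ed d → Em m, Sol Ab w →
      ∀ L : List (ℝ × Ed d), L.length = n → (∀ e ∈ L, Good e) →
      Sol Ab (L.foldr dd w) ∧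
      ∫ q in Qc0 (d := d) r, gradSq (L.foldr dd w) q
        ≤ C * ∫ q in Qc0 (d := d) R, gradSq w q := by
  induction n generalizing r with
  | zero =>
    intro R hrR hR
    refine ⟨1, one_pos, fun m Ab hA hAs w hw L hL _ => ?_⟩
    obtain rfl := List.length_eq_zero_iff.1 hL
    refine ⟨hw, ?_⟩
    rw [one_mul]
    exact Qc0_set_mono (gradSq_cont hw.1) (gradSq_nonneg w) hr.le hrR.le
  | succ n ih =>
    intro R hrR hR
    set ρ : ℝ := (r + R) / 2 with hρ
    have hrρ : r < ρ := by rw [hρ]; linarith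
    have hρR : ρ < R := by rw [hρ]; linarith
    obtain ⟨C1, hC1, h1⟩ := step_est d δ hδ hr hrρ (hρR.le.trans hR)
    obtain ⟨C2, hC2, h2⟩ := ih (hr.trans hrρ) R hρR hR
    refine ⟨C1 * C2, by positivity, fun m Ab hA hAs w hw L hL hg => ?_⟩
    match L, hL with
    | e :: L', hL =>
      have hL' : L'.length = n := by simpa using hL
      obtain ⟨s1, s2⟩ := h2 m Ab hA hAs w hw L' hL' fun e he => hg e (List.mem_cons_of_mem _ he)
      have he : Good e := hg e List.mem_cons_self
      refine ⟨s1.dd hAs he.tan, ?_⟩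
      refine (h1 m Ab hA hAs _ s1 e he).trans ?_
      rw [mul_assoc]
      exact mul_le_mul_of_nonneg_left s2 hC1.le

lemma foldr_dd_smooth {f : ℝ × Ed d → Em m} (hf : ContDiff ℝ (⊤ : ℕ∞) f)
    (L : List (ℝ × Ed d)) : ContDiff ℝ (⊤ : ℕ∞) (L.foldr dd f) := by
  induction L with
  | nil => exact hf
  | cons e L ih => exact dd_smooth ih e

lemma foldr_dd_comm {f : ℝ × Ed d → Em m} (hf : ContDiff ℝ (⊤ : ℕ∞) f)
    (L : List (ℝ × Ed d)) (e : ℝ × Ed d) : L.foldr dd (dd e f) = dd e (L.foldr dd f) := by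
  induction L with
  | nil => rfl
  | cons e' L ih =>
    simp only [List.foldr_cons]
    rw [ih, dd_comm (foldr_dd_smooth hf L)]

lemma foldr_dd_flux [NeZero d] {Ab : Fin d → Fin d → ℝ → CLM m}
    (hA : ∀ α β, ContDiff ℝ (⊤ : ℕ∞) (Ab α β)) {w : ℝ × Ed d → Em m}
    (hw : ContDiff ℝ (⊤ : ℕ∞) w) (L : List (ℝ × Ed d)) (hL : ∀ e ∈ L, Good e) (α : Fin d) :
    L.foldr dd (flux Ab w α) = flux Ab (L.foldr dd w) α := by
  induction L with
  | nil => rfl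
  | cons e L ih =>
    simp only [List.foldr_cons]
    rw [ih fun e he => hL e (List.mem_cons_of_mem _ he),
      dd_flux hA (foldr_dd_smooth hw L) (hL e List.mem_cons_self).tan]

lemma iter_eq (i : ℕ) (l : List (Fin d)) (f : ℝ × Ed d → Em m) :
    pt^[i] (l.foldr pd f) = (List.replicate i ((1 : ℝ), (0 : Ed d)) ++
      l.map fun k => ((0 : ℝ), EuclideanSpace.single k (1 : ℝ))).foldr dd f := by
  rw [List.foldr_append, List.foldr_map]
  have h1 : l.foldr (fun k g => dd ((0 : ℝ), EuclideanSpace.single k (1 : ℝ)) g) f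
      = l.foldr pd f := rfl
  rw [h1]
  generalize l.foldr pd f = g
  induction i with
  | zero => rfl
  | succ i ih =>
    rw [Function.iterate_succ_apply', ih, List.replicate_succ, List.foldr_cons]
    rfl

lemma flux_sq [NeZero d] {δ : ℝ} {Ab : Fin d → Fin d → ℝ → CLM m}
    (hA : CoeffsOne δ Ab) (w : ℝ × Ed d → Em m) (α : Fin d) (q : ℝ × Ed d) :
    ‖flux Ab w α q‖ ^ 2 ≤ (δ⁻¹) ^ 2 * d * gradSq w q := by
  calc ‖flux Ab w α q‖ ^ 2 ≤ (δ⁻¹ * gradS w q) ^ 2 :=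
        pow_le_pow_left₀ (norm_nonneg _) (flux_norm hA w α q) 2
    _ = (δ⁻¹) ^ 2 * gradS w q ^ 2 := by ring
    _ ≤ (δ⁻¹) ^ 2 * (d * gradSq w q) :=
        mul_le_mul_of_nonneg_left (gradS_sq w q) (sq_nonneg _)
    _ = _ := by ring

lemma D1U_sq [NeZero d] {δ : ℝ} {Ab : Fin d → Fin d → ℝ → CLM m}
    (hA : CoeffsOne δ Ab) (hAs : ∀ α β, ContDiff ℝ (⊤ : ℕ∞) (Ab α β)) {w : ℝ × Ed d → Em m}
    (hw : Sol Ab w) (q : ℝ × Ed d) (hq : q ∈ Qc0 (d := d) 4) :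
    ‖pd 0 (flux Ab w 0) q‖ ^ 2 ≤ 2 * ‖pt w q‖ ^ 2 +
      2 * d * ((δ⁻¹) ^ 2 * d) * ∑ α ∈ Finset.univ.erase (0 : Fin d), gradSq (pd α w) q := by
  have h := hw.2 q hq
  rw [← Finset.add_sum_erase _ _ (Finset.mem_univ (0 : Fin d))] at h
  have h' : pd 0 (flux Ab w 0) q
      = pt w q - ∑ α ∈ Finset.univ.erase (0 : Fin d), flux Ab (pd α w) α q := by
    rw [h, eq_sub_iff_add_eq]
    congr 1
    refine Finset.sum_congr rfl fun α hα => ?_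
    have hα0 : α ≠ 0 := (Finset.mem_erase.1 hα).1
    rw [pd_eq, pd_eq, dd_flux hAs hw.1 (Good.tan (Or.inr ⟨α, hα0, rfl⟩))]
  set X := ∑ α ∈ Finset.univ.erase (0 : Fin d), flux Ab (pd α w) α q with hX
  have hXn : ‖X‖ ^ 2 ≤ d * ∑ α ∈ Finset.univ.erase (0 : Fin d), ‖flux Ab (pd α w) α q‖ ^ 2 := by
    calc ‖X‖ ^ 2 ≤ (∑ α ∈ Finset.univ.erase (0 : Fin d), ‖flux Ab (pd α w) α q‖) ^ 2 :=
          pow_le_pow_left₀ (norm_nonneg _) (norm_sum_le _ _) 2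
      _ ≤ (Finset.univ.erase (0 : Fin d)).card *
          ∑ α ∈ Finset.univ.erase (0 : Fin d), ‖flux Ab (pd α w) α q‖ ^ 2 :=
          sq_sum_le_card_mul_sum_sq
      _ ≤ _ := by
          refine mul_le_mul_of_nonneg_right ?_ (Finset.sum_nonneg fun _ _ => sq_nonneg _)
          have := Finset.card_le_univ (Finset.univ.erase (0 : Fin d))
          rw [Fintype.card_fin] at this
          exact_mod_cast this
  have hX2 : ∑ α ∈ Finset.univ.erase (0 : Fin d), ‖flux Ab (pd α w) α q‖ ^ 2
      ≤ (δ⁻¹) ^ 2 * d * ∑ α ∈ Finset.univ.erase (0 : Fin d), gradSq (pd α w) q := by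
    rw [Finset.mul_sum]
    exact Finset.sum_le_sum fun α _ => flux_sq hA _ α q
  have hX3 : ‖X‖ ^ 2 ≤ d * ((δ⁻¹) ^ 2 * d *
      ∑ α ∈ Finset.univ.erase (0 : Fin d), gradSq (pd α w) q) :=
    hXn.trans (mul_le_mul_of_nonneg_left hX2 (Nat.cast_nonneg d))
  have h4 : ‖pd 0 (flux Ab w 0) q‖ ^ 2 ≤ 2 * ‖pt w q‖ ^ 2 + 2 * ‖X‖ ^ 2 := by
    rw [h']
    have h5 : ‖pt w q - X‖ ^ 2 ≤ (‖pt w q‖ + ‖X‖) ^ 2 :=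
      pow_le_pow_left₀ (norm_nonneg _) (norm_sub_le _ _) 2
    nlinarith [sq_nonneg (‖pt w q‖ - ‖X‖)]
  linarith

lemma final_est (d : ℕ) [NeZero d] (δ : ℝ) (hδ : 0 < δ) :
    ∃ C : ℝ, 0 < C ∧ ∀ (m : ℕ) (Ab : Fin d → Fin d → ℝ → CLM m), CoeffsOne δ Ab →
      (∀ α β, ContDiff ℝ (⊤ : ℕ∞) (Ab α β)) → ∀ w : ℝ × Ed d → Em m, Sol Ab w →
      ∫ q in Qc0 (d := d) 2, ‖flux Ab w 0 q‖ ^ 2 ≤ C * ∫ q in Qc0 (d := d) 3, gradSq w q ∧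
      ∫ q in Qc0 (d := d) 2, ‖pd 0 (flux Ab w 0) q‖ ^ 2
        ≤ C * ∫ q in Qc0 (d := d) 3, gradSq w q := by
  obtain ⟨C1, hC1, h1⟩ := time_est d δ hδ (r := 2) (R := 3) (by norm_num) (by norm_num) (by norm_num)
  obtain ⟨C2, hC2, h2⟩ := step_est d δ hδ (r := 2) (R := 3) (by norm_num) (by norm_num) (by norm_num)
  have hd : (0 : ℝ) < d := by exact_mod_cast Nat.pos_of_ne_zero (NeZero.ne d)
  set E : ℝ := 2 * d * ((δ⁻¹) ^ 2 * d) with hE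
  have hE0 : 0 < E := by positivity
  have hP : 0 < (δ⁻¹) ^ 2 * d := by positivity
  refine ⟨(δ⁻¹) ^ 2 * d + (2 * C1 + E * (d * C2)), by positivity, fun m Ab hA hAs w hw => ?_⟩
  set I := ∫ q in Qc0 (d := d) 3, gradSq w q with hI
  have hI0 : 0 ≤ I :=
    setIntegral_nonneg (isOpen_Qc0 3).measurableSet fun q _ => gradSq_nonneg w q
  have hQ0 : 0 ≤ 2 * C1 + E * (d * C2) := by positivity
  rw [add_mul]
  constructor
  · have a1 : ∫ q in Qc0 (d := d) 2, ‖flux Ab w 0 q‖ ^ 2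
        ≤ ∫ q in Qc0 (d := d) 2, (δ⁻¹) ^ 2 * d * gradSq w q :=
      Qc0_int_mono ((flux_smooth hAs hw.1 0).continuous.norm.pow 2)
        (continuous_const.mul (gradSq_cont hw.1)) 2 (fun q _ => flux_sq hA w 0 q)
    rw [integral_const_mul] at a1
    have a2 : ∫ q in Qc0 (d := d) 2, gradSq w q ≤ I :=
      Qc0_set_mono (gradSq_cont hw.1) (gradSq_nonneg w) (by norm_num) (by norm_num)
    have a3 := mul_le_mul_of_nonneg_left a2 hP.le
    have a4 := mul_nonneg hQ0 hI0
    linarith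
  · have c1 : Continuous fun q => ‖pt w q‖ ^ 2 := (pt_smooth hw.1).continuous.norm.pow 2
    have c2 : ∀ α, Continuous (gradSq (pd α w)) := fun α => gradSq_cont (pd_smooth hw.1 α)
    have c3 : Continuous fun q => ∑ α ∈ Finset.univ.erase (0 : Fin d), gradSq (pd α w) q :=
      continuous_finsetSum _ fun α _ => c2 α
    have a1 : ∫ q in Qc0 (d := d) 2, ‖pd 0 (flux Ab w 0) q‖ ^ 2
        ≤ ∫ q in Qc0 (d := d) 2, (2 * ‖pt w q‖ ^ 2 +
          E * ∑ α ∈ Finset.univ.erase (0 : Fin d), gradSq (pd α w) q) :=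
      Qc0_int_mono ((pd_smooth (flux_smooth hAs hw.1 0) 0).continuous.norm.pow 2)
        ((continuous_const.mul c1).add (continuous_const.mul c3)) 2
        (fun q hq => D1U_sq hA hAs hw q (Qc0_mono (by norm_num) (by norm_num) hq))
    rw [integral_add ((integrableOn_Qc0 c1 2).const_mul 2) ((integrableOn_Qc0 c3 2).const_mul E),
      integral_const_mul, integral_const_mul,
      integral_finsetSum _ (fun α _ => integrableOn_Qc0 (c2 α) 2)] at a1
    have a2 := h1 m Ab hA hAs w hw
    have a3 : ∑ α ∈ Finset.univ.erase (0 : Fin d), ∫ q in Qc0 (d := d) 2, gradSq (pd α w) q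
        ≤ d * (C2 * I) := by
      calc _ ≤ ∑ α ∈ Finset.univ.erase (0 : Fin d), C2 * I :=
            Finset.sum_le_sum fun α hα => h2 m Ab hA hAs w hw _
              (Or.inr ⟨α, (Finset.mem_erase.1 hα).1, rfl⟩)
        _ = (Finset.univ.erase (0 : Fin d)).card * (C2 * I) := by
            rw [Finset.sum_const, nsmul_eq_mul]
        _ ≤ _ := by
            refine mul_le_mul_of_nonneg_right ?_ (by positivity)
            have := Finset.card_le_univ (Finset.univ.erase (0 : Fin d))
            rw [Fintype.card_fin] at this
            exact_mod_cast this
    have a4 := mul_le_mul_of_nonneg_left a3 hE0.le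
    have a5 := mul_nonneg hP.le hI0
    calc _ ≤ _ := a1
      _ ≤ 2 * (C1 * I) + E * (d * (C2 * I)) :=
          add_le_add (mul_le_mul_of_nonneg_left a2 (by norm_num)) a4
      _ = (2 * C1 + E * (d * C2)) * I := by ring
      _ ≤ _ := by linarith

end helpers5


/-- For homogeneous systems with smooth coefficients depending only
on `x₁`, setting `U = Σ_β Ā^{1β}(x₁) D_βu`, for all nonnegative `i, j` and any
`j`-fold derivative `D_{x'}^j` in the directions `x₂,…,x_d`,
`‖∂_t^i D_{x'}^j U‖_{L₂(Q₂)} + ‖∂_t^i D_{x'}^j D₁U‖_{L₂(Q₂)} ≤ N‖Du‖_{L₂(Q₄)}`,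
with `N = N(d,m,δ,i,j)` independent of any smoothness norms of `Ā`. -/
theorem stmt_8
    (d m : ℕ) [NeZero d] [NeZero m] (δ : ℝ) (hδ : δ ∈ Set.Ioc (0:ℝ) 1) (i j : ℕ) :
    ∃ N : ℝ, 0 < N ∧
    ∀ (Ab : Fin d → Fin d → ℝ → CLM m), CoeffsOne δ Ab →
      (∀ α β, ContDiff ℝ (⊤ : ℕ∞) (Ab α β)) →
    ∀ u : ℝ × Ed d → Em m, ContDiff ℝ (⊤ : ℕ∞) u →
    -- `-u_t + D_α(Ā^{αβ}(x₁)D_βu) = 0` weakly in `Q₄`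
    (∀ φt : ℝ × Ed d → Em m, ContDiff ℝ (⊤ : ℕ∞) φt → HasCompactSupport φt →
      tsupport φt ⊆ Qc0 4 →
      ∫ q, (⟪u q, pt φt q⟫ - ∑ α, ∑ β, ⟪Ab α β (q.2 0) (pd β u q), pd α φt q⟫) = 0) →
    ∀ l : List (Fin d), l.length = j → (∀ β ∈ l, β ≠ 0) →
      Real.sqrt (∫ q in Qc0 (d := d) 2, ‖pt^[i] (l.foldr pd (Ubar Ab u)) q‖ ^ 2)
        + Real.sqrt (∫ q in Qc0 (d := d) 2, ‖pt^[i] (l.foldr pd (pd 0 (Ubar Ab u))) q‖ ^ 2)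
        ≤ N * Real.sqrt (∫ q in Qc0 (d := d) 4, gradSq u q) := by

  have hδ0 : 0 < δ := hδ.1
  obtain ⟨C1, hC1, h1⟩ := final_est d δ hδ0
  obtain ⟨C2, hC2, h2⟩ := iter_est d δ hδ0 (r := 3) (by norm_num) (i + j) 4 (by norm_num) le_rfl
  have hCp : 0 < Real.sqrt (C1 * C2) := Real.sqrt_pos.2 (by positivity)
  refine ⟨2 * Real.sqrt (C1 * C2), by positivity, ?_⟩
  intro Ab hA hAs u hu hweak l hl hl0
  have hS : Sol Ab u := sol_of_weak hAs hu hweak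
  rw [iter_eq, iter_eq]
  set L : List (ℝ × Ed d) := List.replicate i ((1 : ℝ), (0 : Ed d)) ++
      l.map fun k => ((0 : ℝ), EuclideanSpace.single k (1 : ℝ)) with hL
  have hLlen : L.length = i + j := by simp [hL, hl]
  have hLg : ∀ e ∈ L, Good e := by
    intro e he
    rcases List.mem_append.1 he with h | h
    · exact Or.inl (List.eq_of_mem_replicate h)
    · obtain ⟨k, hk, rfl⟩ := List.mem_map.1 h
      exact Or.inr ⟨k, hl0 k hk, rfl⟩
  obtain ⟨s1, s2⟩ := h2 m Ab hA hAs u hS L hLlen hLg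
  obtain ⟨f1, f2⟩ := h1 m Ab hA hAs _ s1
  rw [Ubar_eq, pd_eq, foldr_dd_comm (flux_smooth hAs hu 0), foldr_dd_flux hAs hu L hLg, ← pd_eq]
  have s3 := mul_le_mul_of_nonneg_left s2 hC1.le
  rw [← mul_assoc] at s3
  have g1 := Real.sqrt_le_sqrt (f1.trans s3)
  have g2 := Real.sqrt_le_sqrt (f2.trans s3)
  rw [Real.sqrt_mul (by positivity)] at g1 g2
  linarith
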